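/- Let m be a positive integer and L, M, N ⊆ [m] with L ≠ [m] and N ≠ [m]. Let D = (1+u^2)Δ_L^c + u^2(Δ_M + (u+u^2)Δ_N^c) ⊆ R^m. Then C_D has length |D| = (2^m − 2^{|L|})(2^m − 2^{|N|})·2^{|M|} and |C_D| = 2^{2m+|M|}; in particular the number of v ∈ R^m with wt_L(c_D(v)) = 0 (equivalently, the size of the kernel of c_D) is 2^{m−|M|}. -/

import Mathlib

open Polynomial
open scoped Classical

noncomputable section

/-- The ring `R = Z₂[u]/⟨u³ - u⟩`. -/
abbrev Rng : Type := AdjoinRoot (X ^ 3 - X : Polynomial (ZMod 2))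

/-- The image `u` of the variable in `R`. -/
def u : Rng := AdjoinRoot.root (X ^ 3 - X : Polynomial (ZMod 2))

/-- The natural inclusion of `Z₂` into `R`. -/
def toRng : ZMod 2 →+* Rng := AdjoinRoot.of _

lemma cubic_monic : (X ^ 3 - X : Polynomial (ZMod 2)).Monic :=
  Polynomial.monic_X_pow_sub (n := 3) (Polynomial.degree_X_le.trans_lt (by norm_num))

/-- The Gray map `Φ : R → Z₂³`, `Φ(a + u b + u² d) = (a + b, b + d, d)`:
every element of `R` is represented by a unique polynomial of degree `< 3`,
whose coefficients are `a, b, d`. -/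
def Phi (r : Rng) : Fin 3 → ZMod 2 :=
  ![(AdjoinRoot.modByMonicHom cubic_monic r).coeff 0 +
      (AdjoinRoot.modByMonicHom cubic_monic r).coeff 1,
    (AdjoinRoot.modByMonicHom cubic_monic r).coeff 1 +
      (AdjoinRoot.modByMonicHom cubic_monic r).coeff 2,
    (AdjoinRoot.modByMonicHom cubic_monic r).coeff 2]

/-- The support of a vector in `Z₂^m`. -/
def supp {m : ℕ} (v : Fin m → ZMod 2) : Finset (Fin m) :=
  Finset.univ.filter (fun i => v i = 1)

/-- The simplicial complex `Δ_X` generated by `X ⊆ [m]`. -/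
def Δ {m : ℕ} (X : Finset (Fin m)) : Finset (Fin m → ZMod 2) :=
  Finset.univ.filter (fun v => supp v ⊆ X)

/-- The Lee weight of a tuple over `R`: the Hamming weight of its coordinatewise Gray image. -/
def wtL {ι : Type} [Fintype ι] (x : ι → Rng) : ℕ :=
  ∑ i, (Finset.univ.filter (fun j : Fin 3 => Phi (x i) j ≠ 0)).card

/-- The defining set `D = (1+u²)D₁ + u²(D₂ + (u+u²)D₃) ⊆ R^m`. -/
def Dset {m : ℕ} (D1 D2 D3 : Finset (Fin m → ZMod 2)) : Finset (Fin m → Rng) :=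
  ((D1 ×ˢ D2) ×ˢ D3).image (fun t i =>
    (1 + u ^ 2) * toRng (t.1.1 i) +
      u ^ 2 * (toRng (t.1.2 i) + (u + u ^ 2) * toRng (t.2 i)))

/-- The codeword `c_D(v) = (v ⬝ d)_{d ∈ D}` of `C_D`. -/
def cD {m : ℕ} (D : Finset (Fin m → Rng)) (v : Fin m → Rng) : D → Rng :=
  fun d => ∑ i, v i * d.1 i


lemma two_dual : (2 : DualNumber (ZMod 2)) = 0 :=
  have h : (2 : ZMod 2) = 0 := by decide
  (map_ofNat (algebraMap (ZMod 2) (DualNumber (ZMod 2))) 2).symm.trans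
    ((congrArg _ h).trans (map_zero _))

/-- The decomposition hom of `R` into `Z₂ × Z₂[ε]`, `u ↦ (0, 1+ε)`. -/
def decHom : Rng →+* ZMod 2 × DualNumber (ZMod 2) :=
  AdjoinRoot.lift (algebraMap (ZMod 2) (ZMod 2 × DualNumber (ZMod 2)))
    (0, 1 + DualNumber.eps) (by
      have he : (DualNumber.eps * DualNumber.eps : DualNumber (ZMod 2)) = 0 :=
        DualNumber.eps_mul_eps
      simp only [eval₂_sub, eval₂_pow, eval₂_X]
      refine Prod.ext ?_ ?_
      · simp
      · simp only [Prod.snd_sub, Prod.pow_snd, Prod.snd_zero]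
        linear_combination (3 + DualNumber.eps) * he + DualNumber.eps * two_dual)

lemma decHom_u : decHom u = (0, 1 + DualNumber.eps) := by
  simp [decHom, u]

lemma decHom_toRng (a : ZMod 2) : decHom (toRng a) = (a, algebraMap _ _ a) := by
  simp only [decHom, toRng, AdjoinRoot.lift_of]
  rfl

/-- Build an element of `R` from its components. -/
def ev (a b c : ZMod 2) : Rng :=
  (1 + u ^ 2) * toRng a + u ^ 2 * (toRng b + (u + u ^ 2) * toRng c)

lemma usq : ((1 + DualNumber.eps) ^ 2 : DualNumber (ZMod 2)) = 1 := by
  have he : (DualNumber.eps * DualNumber.eps : DualNumber (ZMod 2)) = 0 :=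
        DualNumber.eps_mul_eps
  linear_combination he + DualNumber.eps * two_dual

lemma decHom_ev (a b c : ZMod 2) :
    decHom (ev a b c) = (a, algebraMap _ _ b + algebraMap _ _ c * DualNumber.eps) := by
  simp only [ev, map_add, map_mul, map_pow, map_one, decHom_u, decHom_toRng]
  refine Prod.ext ?_ ?_
  · simp
  · simp only [Prod.snd_add, Prod.snd_mul, Prod.pow_snd, Prod.snd_one, usq]
    linear_combination (algebraMap (ZMod 2) (DualNumber (ZMod 2)) a +
      algebraMap (ZMod 2) (DualNumber (ZMod 2)) c) * two_dual

lemma two_rng : (2 : Rng) = 0 :=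
  have h : (2 : ZMod 2) = 0 := by decide
  (map_ofNat toRng 2).symm.trans ((congrArg _ h).trans (map_zero _))

lemma u_cube : u ^ 3 = u := by
  have := AdjoinRoot.eval₂_root (X ^ 3 - X : Polynomial (ZMod 2))
  simp only [eval₂_sub, eval₂_pow, eval₂_X] at this
  exact sub_eq_zero.mp this

lemma natDegree_cubic : (X ^ 3 - X : Polynomial (ZMod 2)).natDegree = 3 := by
  compute_degree!

lemma rng_repr (r : Rng) :
    r = toRng ((AdjoinRoot.modByMonicHom cubic_monic r).coeff 0) +
      toRng ((AdjoinRoot.modByMonicHom cubic_monic r).coeff 1) * u +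
      toRng ((AdjoinRoot.modByMonicHom cubic_monic r).coeff 2) * u ^ 2 := by
  have h1 := AdjoinRoot.mk_leftInverse cubic_monic r
  have hd : (AdjoinRoot.modByMonicHom cubic_monic r).natDegree < 3 := by
    obtain ⟨p, rfl⟩ := AdjoinRoot.mk_surjective r
    rw [AdjoinRoot.modByMonicHom_mk]
    have := Polynomial.natDegree_modByMonic_lt p cubic_monic (by
      intro h
      have := congrArg natDegree h
      rw [natDegree_cubic] at this
      simp at this)
    rwa [natDegree_cubic] at this
  conv_lhs => rw [← h1, Polynomial.as_sum_range' _ 3 hd]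
  simp only [Finset.sum_range_succ, Finset.sum_range_zero, map_add, map_zero, zero_add,
    ← Polynomial.C_mul_X_pow_eq_monomial, map_mul, map_pow, AdjoinRoot.mk_X, AdjoinRoot.mk_C,
    pow_zero, mul_one, pow_one]
  rfl

lemma ev_surj (r : Rng) : ∃ a b c, ev a b c = r := by
  rw [rng_repr r]
  generalize (AdjoinRoot.modByMonicHom cubic_monic r).coeff 0 = a
  generalize (AdjoinRoot.modByMonicHom cubic_monic r).coeff 1 = b
  generalize (AdjoinRoot.modByMonicHom cubic_monic r).coeff 2 = d
  refine ⟨a, a + b + d, b, ?_⟩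
  simp only [ev, map_add]
  have h4 : u ^ 4 = u ^ 2 := by rw [pow_succ, u_cube]; ring
  linear_combination (u ^ 2 * toRng a + u ^ 2 * toRng b) * two_rng + toRng b * u_cube +
    toRng b * h4

/-- Components in `Z₂³`. -/
def comps (r : Rng) : ZMod 2 × ZMod 2 × ZMod 2 :=
  ((decHom r).1, (decHom r).2.fst, (decHom r).2.snd)

lemma comps_ev (a b c : ZMod 2) : comps (ev a b c) = (a, b, c) := by
  simp [comps, decHom_ev, TrivSqZeroExt.algebraMap_eq_inl]

lemma ev_cmp (r : Rng) : ev (comps r).1 (comps r).2.1 (comps r).2.2 = r := by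
  obtain ⟨a, b, c, rfl⟩ := ev_surj r
  rw [comps_ev]

/-- Component equivalence. -/
def compsEquiv : Rng ≃ ZMod 2 × ZMod 2 × ZMod 2 where
  toFun := comps
  invFun t := ev t.1 t.2.1 t.2.2
  left_inv := ev_cmp
  right_inv t := comps_ev _ _ _

lemma comps_inj {r s : Rng} (h : comps r = comps s) : r = s := compsEquiv.injective h

lemma comps_add (r s : Rng) : comps (r + s) = comps r + comps s := by simp [comps]

lemma comps_zero : comps 0 = 0 := by simp [comps]

lemma comps_mul (r s : Rng) : comps (r * s) = ((comps r).1 * (comps s).1, (comps r).2.1 * (comps s).2.1,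
    (comps r).2.1 * (comps s).2.2 + (comps r).2.2 * (comps s).2.1) := by
  simp [comps, mul_comm]

lemma comps_sum {ι : Type} (s : Finset ι) (f : ι → Rng) : comps (∑ i ∈ s, f i) = ∑ i ∈ s, comps (f i) :=
  map_sum (⟨⟨comps, comps_zero⟩, comps_add⟩ : Rng →+ _) f s

lemma Phi_eq_zero (r : Rng) : (∀ j, Phi r j = 0) ↔ r = 0 := by
  constructor
  · intro h
    have h0 := h 0
    have h1 := h 1
    have h2 := h 2
    simp only [Phi, Matrix.cons_val] at h0 h1 h2
    rw [h2, add_zero] at h1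
    rw [h1, add_zero] at h0
    rw [rng_repr r, h0, h1, h2]
    simp
  · rintro rfl j
    fin_cases j <;> simp [Phi]

lemma wtL_eq_zero {ι : Type} [Fintype ι] (x : ι → Rng) : wtL x = 0 ↔ x = 0 := by
  simp only [wtL, Finset.sum_eq_zero_iff, Finset.mem_univ, true_imp_iff, Finset.card_eq_zero,
    Finset.filter_eq_empty_iff, not_not, Phi_eq_zero, funext_iff, Pi.zero_apply]

lemma mem_Δ {m : ℕ} (Y : Finset (Fin m)) (v : Fin m → ZMod 2) :
    v ∈ Δ Y ↔ ∀ i, i ∉ Y → v i = 0 := by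
  have key : ∀ x : ZMod 2, x ≠ 1 ↔ x = 0 := by decide
  simp only [Δ, supp, Finset.mem_filter, Finset.mem_univ, true_and, Finset.subset_iff]
  refine forall_congr' fun i => ?_
  rw [← key]
  tauto

lemma card_Δ {m : ℕ} (Y : Finset (Fin m)) : (Δ Y).card = 2 ^ Y.card := by
  rw [← Finset.card_powerset]
  refine Finset.card_bij (fun v _ => supp v) ?_ ?_ ?_
  · intro v hv
    simpa [Δ] using hv
  · intro v _ w _ h
    have key : ∀ x y : ZMod 2, (x = 1 ↔ y = 1) → x = y := by decide
    funext i
    apply key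
    have := Finset.ext_iff.mp h i
    simpa [supp] using this
  · intro S hS
    refine ⟨fun i => if i ∈ S then 1 else 0, ?_, ?_⟩
    · rw [mem_Δ]
      intro i hi
      have : i ∉ S := fun h => hi (Finset.mem_powerset.mp hS h)
      simp [this]
    · ext i
      simp [supp]

lemma card_Δc {m : ℕ} (Y : Finset (Fin m)) : (((Δ Y)ᶜ.card : ℕ) : ℤ) = 2 ^ m - 2 ^ Y.card := by
  have h := Finset.card_add_card_compl (Δ Y)
  rw [card_Δ] at h
  simp at h
  have : ((2 ^ Y.card + (Δ Y)ᶜ.card : ℕ) : ℤ) = ((2 ^ m : ℕ) : ℤ) := by rw [h]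
  push_cast at this
  linarith

lemma span_Δc {m : ℕ} (Y : Finset (Fin m)) (hY : Y ≠ Finset.univ) (a : Fin m → ZMod 2)
    (h : ∀ t ∈ (Δ Y)ᶜ, ∑ i, a i * t i = 0) : a = 0 := by
  obtain ⟨j, hj⟩ : ∃ j, j ∉ Y := by
    by_contra! hc
    exact hY (Finset.eq_univ_iff_forall.mpr hc)
  have hjc : ∀ t : Fin m → ZMod 2, t j ≠ 0 → ∑ i, a i * t i = 0 := by
    intro t ht
    apply h
    rw [Finset.mem_compl, mem_Δ]
    exact fun hc => ht (hc j hj)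
  have h1 : a j = 0 := by
    have := hjc (Pi.single j 1) (by simp)
    simpa [Pi.single_apply] using this
  funext k
  by_cases hk : k = j
  · rw [hk, h1]; rfl
  · have := hjc (Pi.single j 1 + Pi.single k 1) (by simp [Pi.single_apply, Ne.symm hk])
    simpa [Pi.single_apply, mul_add, Finset.sum_add_distrib, h1] using this

lemma Dset_eq {m : ℕ} (D1 D2 D3 : Finset (Fin m → ZMod 2)) : Dset D1 D2 D3 =
    ((D1 ×ˢ D2) ×ˢ D3).image (fun t i => ev (t.1.1 i) (t.1.2 i) (t.2 i)) := rfl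

lemma card_Dset {m : ℕ} (D1 D2 D3 : Finset (Fin m → ZMod 2)) :
    (Dset D1 D2 D3).card = D1.card * D2.card * D3.card := by
  rw [Dset_eq, Finset.card_image_of_injective, Finset.card_product, Finset.card_product]
  rintro ⟨⟨a, b⟩, c⟩ ⟨⟨a', b'⟩, c'⟩ h
  have h' : ∀ i, (a i, b i, c i) = (a' i, b' i, c' i) := fun i => by
    have := congrArg comps (congrFun h i)
    simpa [comps_ev] using this
  simp only [Prod.mk.injEq] at h' ⊢
  exact ⟨⟨funext fun i => (h' i).1, funext fun i => (h' i).2.1⟩, funext fun i => (h' i).2.2⟩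

lemma ker_iff {m : ℕ} (L M N : Finset (Fin m))
    (hL : L ≠ Finset.univ) (hN : N ≠ Finset.univ) (v : Fin m → Rng) :
    cD (Dset ((Δ L)ᶜ) (Δ M) ((Δ N)ᶜ)) v = 0 ↔
      ∃ c ∈ Δ Mᶜ, v = fun i => ev 0 0 (c i) := by
  have hdot : cD (Dset ((Δ L)ᶜ) (Δ M) ((Δ N)ᶜ)) v = 0 ↔
      ∀ t1 ∈ (Δ L)ᶜ, ∀ t2 ∈ Δ M, ∀ t3 ∈ (Δ N)ᶜ,
        ∑ i, (comps (v i)).1 * t1 i = 0 ∧ ∑ i, (comps (v i)).2.1 * t2 i = 0 ∧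
        ∑ i, ((comps (v i)).2.1 * t3 i + (comps (v i)).2.2 * t2 i) = 0 := by
    have hc : ∀ t1 t2 t3 : Fin m → ZMod 2, ∑ i, v i * ev (t1 i) (t2 i) (t3 i) = 0 ↔
        (∑ i, (comps (v i)).1 * t1 i = 0 ∧ ∑ i, (comps (v i)).2.1 * t2 i = 0 ∧
        ∑ i, ((comps (v i)).2.1 * t3 i + (comps (v i)).2.2 * t2 i) = 0) := by
      intro t1 t2 t3
      have : (∑ i, v i * ev (t1 i) (t2 i) (t3 i) = 0) ↔
          comps (∑ i, v i * ev (t1 i) (t2 i) (t3 i)) = 0 :=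
        ⟨fun h => by rw [h, comps_zero], fun h => comps_inj (by rw [h, comps_zero])⟩
      rw [this, comps_sum]
      simp only [comps_mul, comps_ev, Prod.ext_iff, Prod.fst_sum, Prod.snd_sum, Prod.fst_zero,
        Prod.snd_zero]
    simp only [← hc]
    constructor
    · intro h t1 h1 t2 h2 t3 h3
      exact congrFun h ⟨fun i => ev (t1 i) (t2 i) (t3 i), by
        rw [Dset_eq]
        exact Finset.mem_image.mpr ⟨((t1, t2), t3), by
          simp only [Finset.mem_product]; exact ⟨⟨h1, h2⟩, h3⟩, rfl⟩⟩
    · intro h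
      funext ⟨d, hd⟩
      rw [Dset_eq] at hd
      obtain ⟨⟨⟨t1, t2⟩, t3⟩, ht, rfl⟩ := Finset.mem_image.mp hd
      simp only [Finset.mem_product] at ht
      exact h t1 ht.1.1 t2 ht.1.2 t3 ht.2
  have hne : ∀ Y : Finset (Fin m), Y ≠ Finset.univ → ∃ t, t ∈ (Δ Y)ᶜ := by
    intro Y hY
    obtain ⟨j, hj⟩ : ∃ j, j ∉ Y := by
      by_contra! hc
      exact hY (Finset.eq_univ_iff_forall.mpr hc)
    refine ⟨fun _ => 1, ?_⟩
    rw [Finset.mem_compl, mem_Δ]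
    exact fun hc => one_ne_zero (hc j hj)
  have hz : (0 : Fin m → ZMod 2) ∈ Δ M := by rw [mem_Δ]; simp
  rw [hdot]
  constructor
  · intro h
    obtain ⟨s1, hs1⟩ := hne L hL
    obtain ⟨s3, hs3⟩ := hne N hN
    have ha := span_Δc L hL (fun i => (comps (v i)).1) fun t ht => (h t ht 0 hz s3 hs3).1
    have hb := span_Δc N hN (fun i => (comps (v i)).2.1) fun t ht => by
      simpa using (h s1 hs1 0 hz t ht).2.2
    have hb' : ∀ i, (comps (v i)).2.1 = 0 := congrFun hb
    have ha' : ∀ i, (comps (v i)).1 = 0 := congrFun ha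
    refine ⟨fun i => (comps (v i)).2.2, ?_, ?_⟩
    · rw [mem_Δ]
      intro i hi
      have hi : i ∈ M := by simpa using hi
      have := (h s1 hs1 (Pi.single i 1) (by
        rw [mem_Δ]
        intro k hk
        have : k ≠ i := fun e => hk (e ▸ hi)
        simp [this]) s3 hs3).2.2
      simpa [hb', Pi.single_apply] using this
    · funext i
      conv_lhs => rw [← ev_cmp (v i), ha', hb']
  · rintro ⟨c, hc, rfl⟩ t1 h1 t2 h2 t3 h3
    simp only [comps_ev, zero_mul, Finset.sum_const_zero, zero_add, true_and]
    refine Finset.sum_eq_zero fun i _ => ?_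
    by_cases hi : i ∈ M
    · rw [(mem_Δ _ _).mp hc i (by simpa using hi), zero_mul]
    · rw [(mem_Δ _ _).mp h2 i hi, mul_zero]

lemma card_ker {m : ℕ} (L M N : Finset (Fin m))
    (hL : L ≠ Finset.univ) (hN : N ≠ Finset.univ) :
    Nat.card {v : Fin m → Rng | cD (Dset ((Δ L)ᶜ) (Δ M) ((Δ N)ᶜ)) v = 0} = 2 ^ (m - M.card) := by
  have : {v : Fin m → Rng | cD (Dset ((Δ L)ᶜ) (Δ M) ((Δ N)ᶜ)) v = 0} =
      (((Δ Mᶜ).image fun c i => ev 0 0 (c i) : Finset (Fin m → Rng)) : Set (Fin m → Rng)) := by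
    ext v
    simp only [Set.mem_setOf_eq, ker_iff L M N hL hN, Finset.coe_image, Set.mem_image,
      Finset.mem_coe]
    exact exists_congr fun c => and_congr_right fun _ => eq_comm
  rw [this, Nat.card_coe_set_eq, Set.ncard_coe_finset, Finset.card_image_of_injective, card_Δ,
    Finset.card_compl, Fintype.card_fin]
  intro c c' h
  funext i
  have := congrArg comps (congrFun h i)
  simpa [comps_ev] using this

/-- `c_D` as an additive hom. -/
def cDHom {m : ℕ} (D : Finset (Fin m → Rng)) : (Fin m → Rng) →+ (D → Rng) where
  toFun := cD D
  map_zero' := by funext d; simp [cD]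
  map_add' x y := by funext d; simp [cD, add_mul, Finset.sum_add_distrib]

lemma card_vec (m : ℕ) : Nat.card (Fin m → Rng) = 2 ^ (3 * m) := by
  rw [Nat.card_fun, Nat.card_congr compsEquiv]
  simp [pow_mul]

theorem code_LcMNc (m : ℕ) (hm : 0 < m) (L M N : Finset (Fin m))
    (hL : L ≠ Finset.univ) (hN : N ≠ Finset.univ)
    (D : Finset (Fin m → Rng)) (hD : D = Dset ((Δ L)ᶜ) (Δ M) ((Δ N)ᶜ)) :
    ((D.card : ℤ) = (2 ^ m - 2 ^ L.card) * (2 ^ m - 2 ^ N.card) * 2 ^ M.card) ∧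
    Nat.card (Set.range (cD D)) = 2 ^ (2 * m + M.card) ∧
    Nat.card {v : Fin m → Rng | wtL (cD D v) = 0} = 2 ^ (m - M.card) ∧
    Nat.card {v : Fin m → Rng | cD D v = 0} = 2 ^ (m - M.card) := by
  have hker : Nat.card {v : Fin m → Rng | cD D v = 0} = 2 ^ (m - M.card) := by
    rw [hD]; exact card_ker L M N hL hN
  refine ⟨?_, ?_, ?_, hker⟩
  · rw [hD, card_Dset]
    push_cast
    rw [card_Δc, card_Δc, card_Δ]
    push_cast
    ring
  · have h1 := AddSubgroup.card_eq_card_quotient_mul_card_addSubgroup (cDHom D).ker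
    rw [Nat.card_congr (QuotientAddGroup.quotientKerEquivRange (cDHom D)).toEquiv, card_vec] at h1
    have h2 : Nat.card (cDHom D).ker = 2 ^ (m - M.card) := hker
    have h3 : Nat.card (cDHom D).range = Nat.card (Set.range (cD D)) := rfl
    rw [h2, h3] at h1
    have hM : M.card ≤ m := by simpa using Finset.card_le_univ M
    have h4 : 2 ^ (3 * m) = 2 ^ (2 * m + M.card) * 2 ^ (m - M.card) := by
      rw [← pow_add]; congr 1; omega
    rw [h4] at h1
    exact (Nat.eq_of_mul_eq_mul_right (by positivity) h1).symm
  · simp only [wtL_eq_zero]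
    exact hker


end
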